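/- (Vanishing of Q₀^{(2)}, general form of the paper's Proposition.) Let n, N be natural numbers, E : Matrix n n ℂ, and let g⁺, g⁻ : Fin N → Matrix n n ℂ and a symmetric matrix S : Matrix N N ℂ satisfy: [E, g⁺ᵢ] = Σⱼ Sᵢⱼ g⁺ⱼ and [E, g⁻ᵢ] = −Σⱼ Sᵢⱼ g⁻ⱼ for all i. Assume the contracted commutation conditions: for all i,k, (a) Σⱼ Sᵢⱼ{g⁺ⱼ, g⁺ₖ} = Σⱼ {g⁺ᵢ, g⁺ⱼ} Sⱼₖ, (b) Σⱼ Sᵢⱼ{g⁻ⱼ, g⁻ₖ} = Σⱼ {g⁻ᵢ, g⁻ⱼ} Sⱼₖ, and (c) Σⱼ {g⁺ₖ, g⁻ⱼ} Sⱼᵢ + Σⱼ Sₖⱼ{g⁺ⱼ, g⁻ᵢ} = 0, where {a,b} = ab + ba. Let Λ = ExteriorAlgebra ℂ (Fin (2N) → ℂ), let v, w : Fin N → (Fin (2N) → ℂ) be arbitrary vectors, set ψᵢ = ι(vᵢ), χᵢ = ι(wᵢ) ∈ Λ, and let W = Σᵢ ψᵢ•g⁺ᵢ + χᵢ•g⁻ᵢ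 ∈ Matrix n n Λ, where ψ•A is the matrix with entries ψ·Aᵢⱼ. Then [W, [W, E]] = 0 in Matrix n n Λ. -/

import Mathlib

open Matrix

noncomputable section

/-- For `ψ` in an `R`-algebra `A` and a matrix `M` over `R`, the matrix `ψ•M` over `A` with
entries `ψ · Mᵢⱼ`. -/
def smulMat {m : ℕ} {R : Type*} [CommRing R] {A : Type*} [Ring A] [Algebra R A]
    (ψ : A) (M : Matrix (Fin m) (Fin m) R) : Matrix (Fin m) (Fin m) A :=
  Matrix.of fun i j => ψ * algebraMap R A (M i j)

section SmulMat

variable {m : ℕ} {R : Type*} [CommRing R] {A : Type*} [Ring A] [Algebra R A]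

lemma smulMat_mul_smulMat (ψ χ : A) (M M' : Matrix (Fin m) (Fin m) R) :
    smulMat ψ M * smulMat χ M' = smulMat (ψ * χ) (M * M') := by
  ext i j
  simp only [smulMat, Matrix.mul_apply, Matrix.of_apply, map_sum, map_mul, Finset.mul_sum]
  refine Finset.sum_congr rfl fun k _ => ?_
  rw [mul_assoc ψ, ← mul_assoc (algebraMap R A (M i k)), Algebra.commutes (M i k) χ]
  simp only [mul_assoc]

lemma map_algebraMap_eq_smulMat_one (M : Matrix (Fin m) (Fin m) R) :
    M.map (algebraMap R A) = smulMat 1 M := by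
  ext i j
  simp [smulMat]

lemma smulMat_add (ψ : A) (M M' : Matrix (Fin m) (Fin m) R) :
    smulMat ψ (M + M') = smulMat ψ M + smulMat ψ M' := by
  ext i j
  simp [smulMat, mul_add]

lemma smulMat_sub (ψ : A) (M M' : Matrix (Fin m) (Fin m) R) :
    smulMat ψ (M - M') = smulMat ψ M - smulMat ψ M' := by
  ext i j
  simp [smulMat, mul_sub]

lemma neg_smulMat (ψ : A) (M : Matrix (Fin m) (Fin m) R) :
    smulMat (-ψ) M = -smulMat ψ M := by
  ext i j
  simp [smulMat]

/-- The commutator of two odd matrices is governed by the anticommutator of their coefficients. -/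
lemma smulMat_commutator_of_anticomm {ψ χ : A} (h : χ * ψ = -(ψ * χ))
    (M M' : Matrix (Fin m) (Fin m) R) :
    smulMat ψ M * smulMat χ M' - smulMat χ M' * smulMat ψ M
      = smulMat (ψ * χ) (M * M' + M' * M) := by
  rw [smulMat_mul_smulMat, smulMat_mul_smulMat, h, neg_smulMat, smulMat_add, sub_neg_eq_add]

/-- A Grassmann-odd matrix `W = ∑ θ t • g t` satisfies `[W, [W, E]] = 0` as soon as the
anticommutators `{g s, [E, g t]}` are symmetric in `s` and `t`. -/
lemma double_commutator_sum_smulMat_eq_zero [IsAddTorsionFree A] {T : Type*} [Fintype T]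
    (θ : T → A) (hθ : ∀ s t, θ s * θ t = -(θ t * θ s))
    (g : T → Matrix (Fin m) (Fin m) R) (E : Matrix (Fin m) (Fin m) R)
    (hg : ∀ s t, g s * (E * g t - g t * E) + (E * g t - g t * E) * g s
      = g t * (E * g s - g s * E) + (E * g s - g s * E) * g t) :
    letI W : Matrix (Fin m) (Fin m) A := ∑ t, smulMat (θ t) (g t)
    letI Em : Matrix (Fin m) (Fin m) A := E.map (algebraMap R A)
    W * (W * Em - Em * W) - (W * Em - Em * W) * W = 0 := by
  have hWE : (∑ t, smulMat (θ t) (g t)) * E.map (algebraMap R A)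
      - E.map (algebraMap R A) * (∑ t, smulMat (θ t) (g t))
      = -∑ t, smulMat (θ t) (E * g t - g t * E) := by
    simp only [map_algebraMap_eq_smulMat_one, Finset.sum_mul, Finset.mul_sum,
      smulMat_mul_smulMat, mul_one, one_mul, smulMat_sub, Finset.sum_sub_distrib]
    abel
  have hX : (∑ s, smulMat (θ s) (g s)) * (∑ t, smulMat (θ t) (E * g t - g t * E))
      - (∑ t, smulMat (θ t) (E * g t - g t * E)) * (∑ s, smulMat (θ s) (g s))
      = ∑ s, ∑ t, smulMat (θ s * θ t)
          (g s * (E * g t - g t * E) + (E * g t - g t * E) * g s) := by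
    simp only [Finset.sum_mul_sum, ← smulMat_commutator_of_anticomm (hθ _ _),
      Finset.sum_sub_distrib]
    congr 1
    exact Finset.sum_comm
  have hanti : ∑ s, ∑ t, smulMat (θ s * θ t)
          (g s * (E * g t - g t * E) + (E * g t - g t * E) * g s)
      = -∑ s, ∑ t, smulMat (θ s * θ t)
          (g s * (E * g t - g t * E) + (E * g t - g t * E) * g s) := by
    conv_lhs => rw [Finset.sum_comm]
    simp only [← Finset.sum_neg_distrib]
    refine Finset.sum_congr rfl fun s _ => Finset.sum_congr rfl fun t _ => ?_
    rw [hθ t s, neg_smulMat, hg t s]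
  have : IsAddTorsionFree (Matrix (Fin m) (Fin m) A) :=
    inferInstanceAs (IsAddTorsionFree (Fin m → Fin m → A))
  have hzero := self_eq_neg.mp hanti
  rw [hWE, mul_neg, neg_mul, ← neg_sub', hX, hzero, neg_zero]

end SmulMat

lemma ExteriorAlgebra.ι_mul_ι_eq_neg {R M : Type*} [CommRing R] [AddCommGroup M] [Module R M]
    (x y : M) : ι R x * ι R y = -(ι R y * ι R x) :=
  eq_neg_of_add_eq_zero_left (ι_add_mul_swap x y)

/-- Vanishing of `Q₀⁽²⁾`: general form of the paper's Proposition.  If the ad-`E` action on the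
families `g⁺`, `g⁻` is given by a symmetric matrix `S` (resp. `−S`), and `S` commutes with the
anticommutator structure within each family while anticommuting with the cross structure, then
for `W = Σᵢ ψᵢ•g⁺ᵢ + χᵢ•g⁻ᵢ` with Grassmann coefficients one has `[W,[W,E]] = 0`. -/
theorem stmt7 (n N : ℕ) (E : Matrix (Fin n) (Fin n) ℂ)
    (gp gm : Fin N → Matrix (Fin n) (Fin n) ℂ)
    (S : Matrix (Fin N) (Fin N) ℂ) (hS : S.IsSymm)
    (hp : ∀ i, E * gp i - gp i * E = ∑ j, S i j • gp j)
    (hm : ∀ i, E * gm i - gm i * E = -∑ j, S i j • gm j)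
    (ha : ∀ i k, ∑ j, S i j • (gp j * gp k + gp k * gp j)
        = ∑ j, S j k • (gp i * gp j + gp j * gp i))
    (hb : ∀ i k, ∑ j, S i j • (gm j * gm k + gm k * gm j)
        = ∑ j, S j k • (gm i * gm j + gm j * gm i))
    (hc : ∀ i k, (∑ j, S j i • (gp k * gm j + gm j * gp k))
        + ∑ j, S k j • (gp j * gm i + gm i * gp j) = 0)
    (v w : Fin N → (Fin (2 * N) → ℂ)) :
    letI Λ := ExteriorAlgebra ℂ (Fin (2 * N) → ℂ)
    let ψ : Fin N → Λ := fun i => ExteriorAlgebra.ι ℂ (v i)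
    let χ : Fin N → Λ := fun i => ExteriorAlgebra.ι ℂ (w i)
    let W : Matrix (Fin n) (Fin n) Λ :=
      ∑ i, (smulMat (ψ i) (gp i) + smulMat (χ i) (gm i))
    let Em : Matrix (Fin n) (Fin n) Λ := E.map (algebraMap ℂ Λ)
    W * (W * Em - Em * W) - (W * Em - Em * W) * W = 0 := by
  intro ψ χ W Em
  have hS' : ∀ i j, S j i = S i j := fun i j => hS.apply i j
  have hpm : ∀ i k, gp k * (-∑ j, S i j • gm j) + (-∑ j, S i j • gm j) * gp k
      = gm i * (∑ j, S k j • gp j) + (∑ j, S k j • gp j) * gm i := by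
    intro i k
    have h := eq_neg_of_add_eq_zero_right (hc i k)
    simp only [smul_add, Finset.sum_add_distrib, hS' i] at h
    simp only [mul_neg, neg_mul, Finset.mul_sum, Finset.sum_mul, mul_smul_comm, smul_mul_assoc]
    rw [← neg_add, ← h, add_comm]
  have hW : W = ∑ t, smulMat (Sum.elim ψ χ t) (Sum.elim gp gm t) := by
    simp [W, Fintype.sum_sum_type, Finset.sum_add_distrib]
  have : IsAddTorsionFree (ExteriorAlgebra ℂ (Fin (2 * N) → ℂ)) :=
    .of_module_rat _
  rw [hW]
  refine double_commutator_sum_smulMat_eq_zero _ ?_ _ E ?_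
  · rintro (s | s) (t | t) <;> exact ExteriorAlgebra.ι_mul_ι_eq_neg _ _
  · rintro (s | s) (t | t) <;> simp only [Sum.elim_inl, Sum.elim_inr, hp, hm]
    · have h := ha t s
      simp only [smul_add, Finset.sum_add_distrib, hS' s] at h
      simp only [Finset.mul_sum, Finset.sum_mul, mul_smul_comm, smul_mul_assoc]
      rw [add_comm, h]
    · exact hpm t s
    · exact (hpm s t).symm
    · have h := hb t s
      simp only [smul_add, Finset.sum_add_distrib, hS' s] at h
      simp only [mul_neg, neg_mul, Finset.mul_sum, Finset.sum_mul, mul_smul_comm, smul_mul_assoc]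
      rw [← neg_add, ← neg_add, add_comm, h]

end
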